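/- Let μ = z₁^{a}z₂^{b}z₃^{c} be a monomial of total degree d = a+b+c in which at least two of the exponents a, b, c are positive. Then μ ∈ I·F_{d−2} + F_{d+2g−2}, where I·F_{d−2} denotes the set of sums of products of an element of I with an element of F_{d−2}. -/

import Mathlib

open MvPolynomial

/-- The superpotential `W = -z₁z₂z₃ + z₁^{2g+1} + z₂^{2g+1} + z₃^{2g+1}`
of the Landau–Ginzburg mirror to a genus-`g` curve. -/
noncomputable def superpotential (g : ℕ) : MvPolynomial (Fin 3) ℂ :=
  - (X 0 * X 1 * X 2) + X 0 ^ (2 * g + 1) + X 1 ^ (2 * g + 1) + X 2 ^ (2 * g + 1)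

/-- The Jacobian ideal `I` of `W`, generated by the three partial derivatives. -/
noncomputable def jacobianIdeal (g : ℕ) : Ideal (MvPolynomial (Fin 3) ℂ) :=
  Ideal.span {pderiv 0 (superpotential g), pderiv 1 (superpotential g),
    pderiv 2 (superpotential g)}

/-- `Fdeg m` is the ideal of polynomials all of whose nonzero monomials have total
degree at least `m`. -/
noncomputable def Fdeg (m : ℕ) : Ideal (MvPolynomial (Fin 3) ℂ) where
  carrier := {p | ∀ d ∈ p.support, m ≤ d.sum fun _ e => e}
  zero_mem' := by simp
  add_mem' := by
    intro a b ha hb d hd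
    rcases Finset.mem_union.mp (MvPolynomial.support_add hd) with h | h
    · exact ha d h
    · exact hb d h
  smul_mem' := by
    intro c p hp d hd
    rw [smul_eq_mul] at hd
    obtain ⟨d1, _, d2, hd2, rfl⟩ := Finset.mem_add.mp (MvPolynomial.support_mul c p hd)
    have h2 := hp d2 hd2
    have hsum : (d1 + d2).sum (fun _ e => e) =
        d1.sum (fun _ e => e) + d2.sum (fun _ e => e) :=
      Finsupp.sum_add_index' (fun _ => rfl) (fun _ _ _ => rfl)
    omega

/-- A monomial of total degree at least `m` lies in `Fdeg m`. -/
theorem monomial_mem_Fdeg {m a b c : ℕ} (h : m ≤ a + b + c) :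
    (X 0 ^ a * X 1 ^ b * X 2 ^ c : MvPolynomial (Fin 3) ℂ) ∈ Fdeg m := by
  intro d hd
  have hmon : (X 0 ^ a * X 1 ^ b * X 2 ^ c : MvPolynomial (Fin 3) ℂ) =
      monomial (Finsupp.single 0 a + Finsupp.single 1 b + Finsupp.single 2 c) 1 := by
    simp [X_pow_eq_monomial, monomial_mul]
  rw [hmon] at hd
  obtain rfl := Finset.mem_singleton.mp (support_monomial_subset hd)
  simpa [Finsupp.sum_fintype, Fin.sum_univ_three] using h

theorem pderiv_zero_superpotential (g : ℕ) :
    pderiv 0 (superpotential g) =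
      -(X 1 * X 2) + (2 * (g : MvPolynomial (Fin 3) ℂ) + 1) * X 0 ^ (2 * g) := by
  simp [superpotential, pderiv_X]
  ring

theorem pderiv_one_superpotential (g : ℕ) :
    pderiv 1 (superpotential g) =
      -(X 0 * X 2) + (2 * (g : MvPolynomial (Fin 3) ℂ) + 1) * X 1 ^ (2 * g) := by
  simp [superpotential, pderiv_X]
  ring

theorem pderiv_two_superpotential (g : ℕ) :
    pderiv 2 (superpotential g) =
      -(X 0 * X 1) + (2 * (g : MvPolynomial (Fin 3) ℂ) + 1) * X 2 ^ (2 * g) := by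
  simp [superpotential, pderiv_X]

theorem pderiv_mem_jacobianIdeal (g : ℕ) (i : Fin 3) :
    pderiv i (superpotential g) ∈ jacobianIdeal g := by
  apply Ideal.subset_span
  fin_cases i <;> simp

/-- To place `p` in `I·F_k + F_l`, it suffices to write `p = -(∂ᵢW) r + s t` with `r ∈ F_k`
and `t ∈ F_l`. -/
theorem mem_jacobianIdeal_mul_add {g k l : ℕ} (i : Fin 3) {p r t : MvPolynomial (Fin 3) ℂ}
    (s : MvPolynomial (Fin 3) ℂ) (hr : r ∈ Fdeg k) (ht : t ∈ Fdeg l)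
    (hp : p = -(pderiv i (superpotential g) * r) + s * t) :
    p ∈ jacobianIdeal g * Fdeg k + Fdeg l :=
  hp ▸ Submodule.add_mem_sup
    (neg_mem (Ideal.mul_mem_mul (pderiv_mem_jacobianIdeal g i) hr)) (Ideal.mul_mem_left _ s ht)

/-- If `μ = z₁^a z₂^b z₃^c` is a monomial of total degree `d = a+b+c` in which at least
two of the exponents are positive, then `μ ∈ I·F_{d−2} + F_{d+2g−2}`. -/
theorem stmt_8 (g : ℕ) (hg : 3 ≤ g) (a b c : ℕ)
    (htwo : (0 < a ∧ 0 < b) ∨ (0 < a ∧ 0 < c) ∨ (0 < b ∧ 0 < c)) :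
    (X 0 ^ a * X 1 ^ b * X 2 ^ c : MvPolynomial (Fin 3) ℂ) ∈
      jacobianIdeal g * Fdeg (a + b + c - 2) + Fdeg (a + b + c + 2 * g - 2) := by
  obtain ⟨ha, hb⟩ | ⟨ha, hc⟩ | ⟨hb, hc⟩ := htwo
  · obtain ⟨a, rfl⟩ := Nat.exists_eq_add_of_lt ha
    obtain ⟨b, rfl⟩ := Nat.exists_eq_add_of_lt hb
    refine mem_jacobianIdeal_mul_add 2 (2 * g + 1)
      (monomial_mem_Fdeg (a := a) (b := b) (c := c) (by omega))
      (monomial_mem_Fdeg (a := a) (b := b) (c := c + 2 * g) (by omega)) ?_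
    rw [pderiv_two_superpotential]
    ring
  · obtain ⟨a, rfl⟩ := Nat.exists_eq_add_of_lt ha
    obtain ⟨c, rfl⟩ := Nat.exists_eq_add_of_lt hc
    refine mem_jacobianIdeal_mul_add 1 (2 * g + 1)
      (monomial_mem_Fdeg (a := a) (b := b) (c := c) (by omega))
      (monomial_mem_Fdeg (a := a) (b := b + 2 * g) (c := c) (by omega)) ?_
    rw [pderiv_one_superpotential]
    ring
  · obtain ⟨b, rfl⟩ := Nat.exists_eq_add_of_lt hb
    obtain ⟨c, rfl⟩ := Nat.exists_eq_add_of_lt hc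
    refine mem_jacobianIdeal_mul_add 0 (2 * g + 1)
      (monomial_mem_Fdeg (a := a) (b := b) (c := c) (by omega))
      (monomial_mem_Fdeg (a := a + 2 * g) (b := b) (c := c) (by omega)) ?_
    rw [pderiv_zero_superpotential]
    ring
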